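/- arXiv:2310.06739 — 2 statements merged into one kernel-verified Lean document; each statement's English description precedes it below -/
import Mathlib

section
/- Under conditions (P1)–(P4), for every fixed θ ∈ Ω₂ the set-valued map ξ ↦ U(ξ,θ) is measurable on [0,T]: for every norm-open set O ⊆ Ω₁, the set {ξ ∈ [0,T] : U(ξ,θ) ∩ O ≠ ∅} is Lebesgue measurable. -/
open MeasureTheory Set Filter Topology
open scoped ENNReal

noncomputable section

/-- `SOL K G φ w` is the solution set `SOL(K, w + G(·), φ)` of the generalized mixed
variational inequality: all `u ∈ K` with `⟨w + G(u), v - u⟩ + φ(v) - φ(u) ≥ 0` for all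
`v ∈ K` (written without `EReal` subtraction as `φ(u) ≤ ⟨w + G(u), v - u⟩ + φ(v)`). -/
def SOL {Ω₁ : Type*} [NormedAddCommGroup Ω₁] [NormedSpace ℝ Ω₁]
    (K : Set Ω₁) (G : Ω₁ → (Ω₁ →L[ℝ] ℝ)) (φ : Ω₁ → EReal) (w : Ω₁ →L[ℝ] ℝ) : Set Ω₁ :=
  {u | u ∈ K ∧ ∀ v ∈ K, φ u ≤ ((w (v - u) + (G u) (v - u) : ℝ) : EReal) + φ v}

/-- (P1): `G` is monotone on `K` and hemicontinuous on `K`. -/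
def condP1 {Ω₁ : Type*} [NormedAddCommGroup Ω₁] [NormedSpace ℝ Ω₁]
    (K : Set Ω₁) (G : Ω₁ → (Ω₁ →L[ℝ] ℝ)) : Prop :=
  (∀ u ∈ K, ∀ v ∈ K, 0 ≤ (G v - G u) (v - u)) ∧
  (∀ u ∈ K, ∀ v ∈ K, ∀ x : Ω₁,
    ContinuousOn (fun t : ℝ => (G (u + t • (v - u))) x) (Icc (0:ℝ) 1))

/-- (P2): `φ : Ω₁ → ℝ ∪ {+∞}` (an `EReal`-valued map never taking the value `⊥`) is
proper, convex and lower semicontinuous. -/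
def condP2 {Ω₁ : Type*} [NormedAddCommGroup Ω₁] [NormedSpace ℝ Ω₁] (φ : Ω₁ → EReal) : Prop :=
  (∀ u, φ u ≠ ⊥) ∧ (∃ u, φ u ≠ ⊤) ∧
  (∀ u v : Ω₁, ∀ t : ℝ, t ∈ Icc (0:ℝ) 1 →
    φ (t • u + (1 - t) • v) ≤ (t : EReal) * φ u + ((1 - t : ℝ) : EReal) * φ v) ∧
  LowerSemicontinuous φ

/-- (P3): coercivity: there is `v* ∈ K ∩ D(φ)` with
`(⟨G(u), u - v*⟩ + φ(u) - φ(v*))/‖u‖ → +∞` as `‖u‖ → ∞`, `u ∈ K`. -/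
def condP3 {Ω₁ : Type*} [NormedAddCommGroup Ω₁] [NormedSpace ℝ Ω₁]
    (K : Set Ω₁) (G : Ω₁ → (Ω₁ →L[ℝ] ℝ)) (φ : Ω₁ → EReal) : Prop :=
  ∃ vs ∈ K, φ vs ≠ ⊤ ∧
    ∀ M : ℝ, ∃ R : ℝ, ∀ u ∈ K, R ≤ ‖u‖ →
      ((M * ‖u‖ : ℝ) : EReal) + φ vs ≤ (((G u) (u - vs) : ℝ) : EReal) + φ u

/-- (P4): `g` is continuous and bounded on `[0,T] × Ω₂`. -/
def condP4 {Ω₁ Ω₂ : Type*} [NormedAddCommGroup Ω₁] [NormedSpace ℝ Ω₁]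
    [NormedAddCommGroup Ω₂] [NormedSpace ℝ Ω₂]
    (T : ℝ) (g : ℝ → Ω₂ → (Ω₁ →L[ℝ] ℝ)) : Prop :=
  ContinuousOn (fun p : ℝ × Ω₂ => g p.1 p.2) (Icc (0:ℝ) T ×ˢ univ) ∧
  ∃ C : ℝ, ∀ ξ ∈ Icc (0:ℝ) T, ∀ θ : Ω₂, ‖g ξ θ‖ ≤ C

lemma weak_limit_aux {E ι : Type*} [NormedAddCommGroup E] [NormedSpace ℝ E]
    (hrefl : Function.Surjective ⇑(NormedSpace.inclusionInDoubleDual ℝ E))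
    (F : Ultrafilter ι) (u : ι → E) (R : ℝ) (hu : ∀ᶠ i in (F : Filter ι), ‖u i‖ ≤ R) :
    ∃ u₀ : E, ∀ f : E →L[ℝ] ℝ, Tendsto (fun i => f (u i)) F (𝓝 (f u₀)) := by
  let J : ι → WeakDual ℝ (StrongDual ℝ E) := fun i =>
    StrongDual.toWeakDual (NormedSpace.inclusionInDoubleDual ℝ E (u i))
  have hc := WeakDual.isCompact_closedBall (𝕜 := ℝ) (E := StrongDual ℝ E) 0 R
  have hle : ((F.map J : Ultrafilter _) : Filter _) ≤
      𝓟 (WeakDual.toStrongDual ⁻¹' Metric.closedBall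
        (0 : StrongDual ℝ (StrongDual ℝ E)) R) := by
    rw [le_principal_iff]
    change ∀ᶠ i in (F : Filter ι), J i ∈ _
    filter_upwards [hu] with i hi
    change NormedSpace.inclusionInDoubleDual ℝ E (u i) ∈ Metric.closedBall _ R
    refine (mem_closedBall_zero_iff (E := StrongDual ℝ (StrongDual ℝ E))).2 ?_
    exact (NormedSpace.double_dual_bound ℝ E (u i)).trans hi
  obtain ⟨x, -, hx⟩ := hc.ultrafilter_le_nhds _ hle
  obtain ⟨u₀, hu₀⟩ := hrefl (WeakDual.toStrongDual x)
  refine ⟨u₀, fun f => ?_⟩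
  have h1 : Tendsto J F (𝓝 x) := hx
  have h2 := ((WeakDual.eval_continuous f).tendsto x).comp h1
  have h3 : x f = f u₀ := by
    rw [← NormedSpace.dual_def ℝ E u₀ f, hu₀]; rfl
  rw [h3] at h2
  exact h2

lemma weak_closed_aux {E ι : Type*} [NormedAddCommGroup E] [NormedSpace ℝ E]
    (F : Filter ι) [F.NeBot] (u : ι → E) (u₀ : E)
    (h : ∀ f : E →L[ℝ] ℝ, Tendsto (fun i => f (u i)) F (𝓝 (f u₀)))
    (C : Set E) (hC : IsClosed C) (hcv : Convex ℝ C) (hu : ∀ᶠ i in F, u i ∈ C) : u₀ ∈ C := by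
  by_contra hn
  obtain ⟨f, c, h1, h2⟩ := geometric_hahn_banach_closed_point hcv hC hn
  have : f u₀ ≤ c := le_of_tendsto (h f) (by
    filter_upwards [hu] with i hi
    exact (h1 _ hi).le)
  linarith

lemma sublevel_convex_aux {E : Type*} [NormedAddCommGroup E] [NormedSpace ℝ E]
    (φ : E → EReal) (hP2 : condP2 φ) (c : ℝ) : Convex ℝ {u | φ u ≤ (c : EReal)} := by
  intro x hx y hy a b ha hb hab
  have h := hP2.2.2.1 x y a ⟨ha, by linarith⟩
  have hb' : b = 1 - a := by linarith
  subst hb'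
  refine h.trans ?_
  have hfin : ∀ z, φ z ≤ (c : EReal) → ∃ r : ℝ, φ z = r ∧ r ≤ c := by
    intro z hz
    have : φ z ≠ ⊤ := fun h => by simp [h] at hz
    refine ⟨(φ z).toReal, (EReal.coe_toReal this (hP2.1 z)).symm, ?_⟩
    rw [← EReal.coe_le_coe_iff, EReal.coe_toReal this (hP2.1 z)]
    exact hz
  obtain ⟨r, hr, hrc⟩ := hfin x hx
  obtain ⟨s, hs, hsc⟩ := hfin y hy
  rw [hr, hs, ← EReal.coe_mul, ← EReal.coe_mul, ← EReal.coe_add, EReal.coe_le_coe_iff]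
  nlinarith

lemma minty_forward_aux {E : Type*} [NormedAddCommGroup E] [NormedSpace ℝ E]
    (K : Set E) (G : E → (E →L[ℝ] ℝ)) (φ : E → EReal) (hP1 : condP1 K G)
    (w : E →L[ℝ] ℝ) (u : E) (hu : u ∈ SOL K G φ w) :
    ∀ v ∈ K, φ u ≤ ((w (v - u) + (G v) (v - u) : ℝ) : EReal) + φ v := by
  intro v hv
  refine (hu.2 v hv).trans ?_
  have h := hP1.1 u hu.1 v hv
  rw [ContinuousLinearMap.sub_apply] at h
  gcongr
  linarith

lemma minty_backward_aux {E : Type*} [NormedAddCommGroup E] [NormedSpace ℝ E]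
    (K : Set E) (hKcv : Convex ℝ K) (G : E → (E →L[ℝ] ℝ)) (φ : E → EReal) (hP1 : condP1 K G)
    (hP2 : condP2 φ) (hdom : ∃ v ∈ K, φ v ≠ ⊤)
    (w : E →L[ℝ] ℝ) (u : E) (huK : u ∈ K)
    (hu : ∀ v ∈ K, ∀ b : ℝ, φ v = b → φ u ≤ ((w (v - u) + (G v) (v - u) + b : ℝ) : EReal)) :
    u ∈ SOL K G φ w := by
  have hreal : ∀ z, φ z ≠ ⊤ → ∃ r : ℝ, φ z = r := fun z hz =>
    ⟨(φ z).toReal, (EReal.coe_toReal hz (hP2.1 z)).symm⟩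
  obtain ⟨a, ha⟩ : ∃ a : ℝ, φ u = a := by
    obtain ⟨v, hv, hvt⟩ := hdom
    obtain ⟨b, hb⟩ := hreal v hvt
    refine hreal u fun h => ?_
    have := hu v hv b hb
    rw [h, top_le_iff] at this
    exact EReal.coe_ne_top _ this
  refine ⟨huK, fun v hv => ?_⟩
  by_cases hvt : φ v = ⊤
  · rw [hvt, EReal.coe_add_top]; exact le_top
  obtain ⟨b, hb⟩ := hreal v hvt
  rw [ha, hb, ← EReal.coe_add, EReal.coe_le_coe_iff]
  have hcont := hP1.2 u huK v hv (v - u)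
  have h0 := hcont 0 (by simp)
  have h1 : Tendsto (fun t : ℝ => (G (u + t • (v - u))) (v - u)) (𝓝[Ioc 0 1] 0)
      (𝓝 (G u (v - u))) := by
    have := h0.mono_left (nhdsWithin_mono 0 (Ioc_subset_Icc_self))
    simpa using this
  have hne : (𝓝[Ioc (0:ℝ) 1] 0).NeBot := by
    rw [nhdsWithin_Ioc_eq_nhdsGT zero_lt_one]; infer_instance
  have h2 : Tendsto (fun t : ℝ => w (v - u) + (G (u + t • (v - u))) (v - u) + b)
      (𝓝[Ioc 0 1] 0) (𝓝 (w (v - u) + G u (v - u) + b)) := (h1.const_add _).add_const _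
  refine ge_of_tendsto h2 ?_
  filter_upwards [self_mem_nhdsWithin] with t ht
  have heq : u + t • (v - u) = t • v + (1 - t) • u := by module
  have hmem : u + t • (v - u) ∈ K := by
    rw [heq]; exact hKcv hv huK ht.1.le (by linarith [ht.2]) (by ring)
  have hφ := hP2.2.2.1 v u t ⟨ht.1.le, ht.2⟩
  rw [← heq, ha, hb, ← EReal.coe_mul, ← EReal.coe_mul, ← EReal.coe_add] at hφ
  obtain ⟨c, hc⟩ := hreal (u + t • (v - u)) (fun h => by
    rw [h, top_le_iff] at hφ
    exact EReal.coe_ne_top _ hφ)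
  have h3 := hu _ hmem c hc
  rw [hc, EReal.coe_le_coe_iff] at hφ
  rw [ha, EReal.coe_le_coe_iff, add_sub_cancel_left, map_smul, map_smul, smul_eq_mul,
    smul_eq_mul] at h3
  have : t * a ≤ t * (w (v - u) + (G (u + t • (v - u))) (v - u) + b) := by nlinarith
  exact le_of_mul_le_mul_left this ht.1

lemma closed_aux {E : Type*} [NormedAddCommGroup E] [NormedSpace ℝ E]
    (hrefl : Function.Surjective ⇑(NormedSpace.inclusionInDoubleDual ℝ E))
    (K : Set E) (hKcl : IsClosed K) (hKcv : Convex ℝ K)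
    (G : E → (E →L[ℝ] ℝ)) (φ : E → EReal)
    (hP1 : condP1 K G) (hP2 : condP2 φ) (hdom : ∃ v ∈ K, φ v ≠ ⊤)
    (I : Set ℝ) (hI : IsClosed I) (w : ℝ → (E →L[ℝ] ℝ)) (hw : ContinuousOn w I)
    (d : E) (r : ℝ) :
    IsClosed {ξ ∈ I | (SOL K G φ (w ξ) ∩ Metric.closedBall d r).Nonempty} := by
  rw [isClosed_iff_ultrafilter]
  intro ξ F hF hmem
  have hFI : I ∈ (F : Filter ℝ) := mem_of_superset hmem (fun x hx => hx.1)
  have hξI : ξ ∈ I := (isClosed_iff_ultrafilter.1 hI) ξ F hF hFI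
  refine ⟨hξI, ?_⟩
  have hch : ∀ x, ∃ u : E, x ∈ {ξ ∈ I | (SOL K G φ (w ξ) ∩ Metric.closedBall d r).Nonempty} →
      u ∈ SOL K G φ (w x) ∩ Metric.closedBall d r := by
    intro x
    by_cases hx : x ∈ {ξ ∈ I | (SOL K G φ (w ξ) ∩ Metric.closedBall d r).Nonempty}
    · obtain ⟨u, hu⟩ := hx.2
      exact ⟨u, fun _ => hu⟩
    · exact ⟨0, fun h => absurd h hx⟩
  choose u hu using hch
  have hev : ∀ᶠ x in (F : Filter ℝ), u x ∈ SOL K G φ (w x) ∩ Metric.closedBall d r :=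
    mem_of_superset hmem hu
  have hbd : ∀ᶠ x in (F : Filter ℝ), ‖u x‖ ≤ r + ‖d‖ := by
    filter_upwards [hev] with x hx
    have h := hx.2
    rw [mem_closedBall_iff_norm] at h
    have := norm_le_norm_sub_add (u x) d
    linarith
  obtain ⟨u₀, hu₀⟩ := weak_limit_aux hrefl F u _ hbd
  refine ⟨u₀, ?_, ?_⟩
  · have hK : u₀ ∈ K := weak_closed_aux F u u₀ hu₀ K hKcl hKcv (hev.mono fun x hx => hx.1.1)
    refine minty_backward_aux K hKcv G φ hP1 hP2 hdom (w ξ) u₀ hK fun v hv b hb => ?_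
    have hwF : Tendsto w F (𝓝 (w ξ)) :=
      (hw ξ hξI).mono_left (le_inf hF (le_principal_iff.2 hFI))
    have hdiff : Tendsto (fun x => (w x - w ξ) (v - u x)) F (𝓝 0) := by
      have hn : Tendsto (fun x => ‖w x - w ξ‖ * (‖v‖ + (r + ‖d‖))) F (𝓝 0) := by
        have := (tendsto_iff_norm_sub_tendsto_zero.1 hwF).mul_const (‖v‖ + (r + ‖d‖))
        simpa using this
      refine squeeze_zero_norm' ?_ hn
      filter_upwards [hbd] with x hx
      refine ((w x - w ξ).le_opNorm _).trans ?_
      gcongr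
      exact (norm_sub_le _ _).trans (by linarith)
    have hlim : Tendsto (fun x => w x (v - u x) + (G v) (v - u x) + b) F
        (𝓝 (w ξ (v - u₀) + (G v) (v - u₀) + b)) := by
      have h1 := ((hdiff.add ((hu₀ (w ξ)).const_sub (w ξ v))).add
        ((hu₀ (G v)).const_sub (G v v))).add_const b
      convert h1 using 2
      · simp only [ContinuousLinearMap.sub_apply, map_sub]; ring
      · simp only [map_sub]; ring
    refine EReal.le_of_forall_lt_iff_le.1 fun z hz => ?_
    rw [EReal.coe_lt_coe_iff] at hz
    have hsub : IsClosed {y | φ y ≤ (z : EReal)} := hP2.2.2.2.isClosed_preimage _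
    refine weak_closed_aux F u u₀ hu₀ _ hsub (sublevel_convex_aux φ hP2 z) ?_
    filter_upwards [hev, hlim.eventually_lt_const hz] with x hx hxz
    have := minty_forward_aux K G φ hP1 (w x) (u x) hx.1 v hv
    rw [hb, ← EReal.coe_add] at this
    exact this.trans (EReal.coe_le_coe_iff.2 hxz.le)
  · exact weak_closed_aux F u u₀ hu₀ _ Metric.isClosed_closedBall (convex_closedBall d r)
      (hev.mono fun x hx => hx.2)

/-- **Theorem 3.4 (ii)**: for each fixed `θ`, the multimap `ξ ↦ U(ξ,θ)` is (Lebesgue)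
measurable on `[0,T]`. -/
theorem U_measurable_in_time
    {Ω₁ Ω₂ : Type*} [NormedAddCommGroup Ω₁] [NormedSpace ℝ Ω₁] [CompleteSpace Ω₁]
    [TopologicalSpace.SeparableSpace Ω₁]
    [NormedAddCommGroup Ω₂] [NormedSpace ℝ Ω₂] [CompleteSpace Ω₂]
    [TopologicalSpace.SeparableSpace Ω₂]
    (hΩ₁refl : Function.Surjective ⇑(NormedSpace.inclusionInDoubleDual ℝ Ω₁))
    (hΩ₂refl : Function.Surjective ⇑(NormedSpace.inclusionInDoubleDual ℝ Ω₂))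
    (K : Set Ω₁) (hKne : K.Nonempty) (hKcl : IsClosed K) (hKcv : Convex ℝ K)
    (G : Ω₁ → (Ω₁ →L[ℝ] ℝ)) (φ : Ω₁ → EReal)
    (hP1 : condP1 K G) (hP2 : condP2 φ) (hP3 : condP3 K G φ)
    {T : ℝ} (hT : 0 < T)
    (g : ℝ → Ω₂ → (Ω₁ →L[ℝ] ℝ)) (hP4 : condP4 T g)
    : ∀ θ : Ω₂, ∀ O : Set Ω₁, IsOpen O →
      MeasureTheory.NullMeasurableSet
        {ξ ∈ Icc (0:ℝ) T | (SOL K G φ (g ξ θ) ∩ O).Nonempty} volume := by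
  intro θ O hO
  have hw : ContinuousOn (fun ξ => g ξ θ) (Icc (0:ℝ) T) :=
    hP4.1.comp (by fun_prop : ContinuousOn (fun ξ : ℝ => (ξ, θ)) (Icc (0:ℝ) T))
      (fun x hx => ⟨hx, mem_univ _⟩)
  have hdom : ∃ v ∈ K, φ v ≠ ⊤ := by
    obtain ⟨v, hv, hvt, -⟩ := hP3
    exact ⟨v, hv, hvt⟩
  have hkey : {ξ ∈ Icc (0:ℝ) T | (SOL K G φ (g ξ θ) ∩ O).Nonempty} =
      ⋃ p : {p : ℕ × ℕ // Metric.closedBall (TopologicalSpace.denseSeq Ω₁ p.1)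
          (1 / ((p.2 : ℝ) + 1)) ⊆ O},
        {ξ ∈ Icc (0:ℝ) T | (SOL K G φ (g ξ θ) ∩
          Metric.closedBall (TopologicalSpace.denseSeq Ω₁ p.1.1)
            (1 / ((p.1.2 : ℝ) + 1))).Nonempty} := by
    ext ξ
    simp only [mem_iUnion]
    constructor
    · rintro ⟨hξ, u, hu, huO⟩
      obtain ⟨ε, hε, hball⟩ := Metric.isOpen_iff.1 hO u huO
      obtain ⟨n, hn⟩ := exists_nat_one_div_lt (half_pos hε)
      have hpos : (0:ℝ) < 1 / ((n : ℝ) + 1) := by positivity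
      obtain ⟨m, hm⟩ := (TopologicalSpace.denseRange_denseSeq Ω₁).exists_dist_lt u hpos
      refine ⟨⟨(m, n), fun y hy => hball ?_⟩, hξ, u, hu, ?_⟩
      · rw [Metric.mem_closedBall] at hy
        rw [Metric.mem_ball]
        have := dist_triangle_right y u (TopologicalSpace.denseSeq Ω₁ m)
        simp only at hy
        linarith
      · exact Metric.mem_closedBall.2 hm.le
    · rintro ⟨p, hξ, u, hu, hub⟩
      exact ⟨hξ, u, hu, p.2 hub⟩
  rw [hkey]
  exact (MeasurableSet.iUnion fun p => (closed_aux hΩ₁refl K hKcl hKcv G φ hP1 hP2 hdom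
    (Icc 0 T) isClosed_Icc (fun ξ => g ξ θ) hw _ _).measurableSet).nullMeasurableSet
end
end

section
/- Under conditions (P1)–(P4), and assuming SOL(K, w + G(·), φ) is nonempty for every w ∈ Ω₁*, the set-valued map P_U : C([0,T],Ω₂) → P(L²([0,T],Ω₁)) is strongly-weakly upper semicontinuous: for every θ₀ ∈ C([0,T],Ω₂) and every set O ⊆ L²([0,T],Ω₁) that is open in the weak topology of L²([0,T],Ω₁) and satisfies P_U(θ₀) ⊆ O, there exists δ > 0 such that P_U(θ) ⊆ O whenever ‖θ − θ₀‖_c < δ. -/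
open MeasureTheory Set Filter Topology
open scoped ENNReal

noncomputable section

/-- Extension of `θ ∈ C([0,T], Ω₂)` to all of `ℝ` by projecting onto `[0,T]`
(only its values on `[0,T]` are ever used). -/
def extIcc {Ω₂ : Type*} [TopologicalSpace Ω₂] {T : ℝ} (hT : (0:ℝ) ≤ T)
    (θ : C(Icc (0:ℝ) T, Ω₂)) (s : ℝ) : Ω₂ :=
  θ (Set.projIcc 0 T hT s)

/-- The weak topology of a real normed space `E`: the topology induced by the
canonical map from `E` into `(E →L[ℝ] ℝ) → ℝ` (with the product topology). -/
def weakTop (E : Type*) [NormedAddCommGroup E] [NormedSpace ℝ E] : TopologicalSpace E :=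
  TopologicalSpace.induced (fun (x : E) (f : E →L[ℝ] ℝ) => f x) inferInstance

/-- `P_U(θ)` as a subset of the Lebesgue space `L²([0,T], Ω₁)`. -/
def PULp {Ω₁ Ω₂ : Type*} [NormedAddCommGroup Ω₁] [NormedSpace ℝ Ω₁]
    [NormedAddCommGroup Ω₂] [NormedSpace ℝ Ω₂]
    (K : Set Ω₁) (G : Ω₁ → (Ω₁ →L[ℝ] ℝ)) (φ : Ω₁ → EReal)
    {T : ℝ} (hT : (0:ℝ) ≤ T) (g : ℝ → Ω₂ → (Ω₁ →L[ℝ] ℝ))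
    (θ : C(Icc (0:ℝ) T, Ω₂)) :
    Set (Lp Ω₁ 2 (volume.restrict (Icc (0:ℝ) T))) :=
  {l | ∀ᵐ ξ ∂(volume.restrict (Icc (0:ℝ) T)), l ξ ∈ SOL K G φ (g ξ (extIcc hT θ ξ))}

theorem aux_extend {X : Type*} [NormedAddCommGroup X] [NormedSpace ℝ X]
    (D : AddSubgroup X) (hD : Dense (D : Set X)) (a : X → ℝ)
    (hadd : ∀ d ∈ D, ∀ e ∈ D, a (d + e) = a d + a e) (M : NNReal)
    (hb : ∀ d ∈ D, |a d| ≤ M * ‖d‖) :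
    ∃ F : X →L[ℝ] ℝ, ‖F‖ ≤ M ∧ ∀ d ∈ D, F d = a d := by
  have hL : LipschitzOnWith M a D := by
    apply LipschitzOnWith.of_dist_le_mul
    intro x hx y hy
    have h1 := hadd (x - y) (D.sub_mem hx hy) y hy
    rw [sub_add_cancel] at h1
    rw [Real.dist_eq, dist_eq_norm, h1, add_sub_cancel_right]
    exact hb _ (D.sub_mem hx hy)
  obtain ⟨F, hF, hFa⟩ := hL.extend_real
  have hFadd : ∀ x y, F (x + y) = F x + F y := by
    have hc : IsClosed {p : X × X | F (p.1 + p.2) = F p.1 + F p.2} := by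
      apply isClosed_eq
      · exact hF.continuous.comp (continuous_fst.add continuous_snd)
      · exact (hF.continuous.comp continuous_fst).add (hF.continuous.comp continuous_snd)
    have hd : Dense ((D : Set X) ×ˢ (D : Set X)) := hD.prod hD
    have hs : ((D : Set X) ×ˢ (D : Set X)) ⊆ {p : X × X | F (p.1 + p.2) = F p.1 + F p.2} := by
      rintro ⟨x, y⟩ ⟨hx, hy⟩
      simp only [mem_ofPred_eq]
      rw [← hFa hx, ← hFa hy, ← hFa (D.add_mem hx hy)]
      exact hadd x hx y hy
    intro x y
    have := hc.closure_subset_iff.2 hs (hd (x, y))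
    exact this
  let Fh : X →+ ℝ := AddMonoidHom.mk' F hFadd
  have h0 : F 0 = 0 := Fh.map_zero
  refine ⟨Fh.toRealLinearMap hF.continuous, ?_, fun d hd => (hFa hd).symm⟩
  apply ContinuousLinearMap.opNorm_le_bound _ M.2
  intro x
  have := hF.dist_le_mul x 0
  rw [h0, dist_zero_right, dist_zero_right] at this
  exact this

theorem aux_sep_of_dual {E : Type*} [NormedAddCommGroup E] [NormedSpace ℝ E]
    [TopologicalSpace.SeparableSpace (E →L[ℝ] ℝ)] : TopologicalSpace.SeparableSpace E := by
  let f := TopologicalSpace.denseSeq (E →L[ℝ] ℝ)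
  have h1 : ∀ n, ∃ x : E, ‖x‖ ≤ 1 ∧ ‖f n‖ / 2 ≤ |f n x| := by
    intro n
    by_cases h0 : f n = 0
    · exact ⟨0, by simp, by simp [h0]⟩
    have : 0 < ‖f n‖ := norm_pos_iff.2 h0
    obtain ⟨x, hx, hx2⟩ := (f n).exists_lt_apply_of_lt_opNorm (half_lt_self this)
    exact ⟨x, hx.le, hx2.le⟩
  choose x hx hfx using h1
  let V : Submodule ℝ E := (Submodule.span ℝ (range x)).topologicalClosure
  have hV : (V : Set E) = univ := by
    by_contra hne
    obtain ⟨y, hy⟩ := (ne_univ_iff_exists_notMem _).1 hne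
    obtain ⟨u, c, hu, hc⟩ := geometric_hahn_banach_closed_point V.convex
      (Submodule.isClosed_topologicalClosure _) hy
    have hz : ∀ v ∈ V, u v = 0 := by
      intro v hv
      by_contra hne
      have := hu ((c / u v) • v) (V.smul_mem _ hv)
      rw [map_smul, smul_eq_mul, div_mul_cancel₀ _ hne] at this
      exact lt_irrefl _ this
    have hu0 : u = 0 := by
      rw [← norm_le_zero_iff]
      apply le_of_forall_pos_lt_add
      intro ε hε
      obtain ⟨n, hn⟩ := (TopologicalSpace.denseRange_denseSeq (E →L[ℝ] ℝ)).exists_dist_lt u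
        (show 0 < ε / 3 by positivity)
      rw [dist_eq_norm] at hn
      have e1 : u (x n) = 0 := hz _ (Submodule.le_topologicalClosure _
        (Submodule.subset_span (mem_range_self n)))
      have e2 : |f n (x n)| ≤ ‖u - f n‖ := by
        have := (u - f n).le_opNorm (x n)
        simp only [sub_apply, e1, zero_sub, norm_neg, Real.norm_eq_abs] at this
        exact this.trans (mul_le_of_le_one_right (norm_nonneg _) (hx n))
      have e3 := hfx n
      have e4 : ‖u‖ ≤ ‖u - f n‖ + ‖f n‖ := by simpa using norm_add_le (u - f n) (f n)
      change ‖u - f n‖ < _ at hn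
      linarith
    have := hu 0 V.zero_mem
    simp [hu0] at hc this
    linarith
  have hsep : TopologicalSpace.IsSeparable (V : Set E) := by
    have : TopologicalSpace.IsSeparable (Submodule.span ℝ (range x) : Set E) :=
      (TopologicalSpace.isSeparable_range (continuous_of_discreteTopology (f := x))).span
    exact this.closure
  rw [hV] at hsep
  exact TopologicalSpace.isSeparable_univ_iff.1 hsep


theorem aux_countable_closure {X : Type*} [AddCommGroup X] {s : Set X} (hs : s.Countable) :
    Countable (AddSubgroup.closure s) := by
  have : Countable s := hs
  have h : AddSubgroup.closure s = (FreeAddGroup.lift (fun x : s => (x : X))).range := by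
    rw [FreeAddGroup.range_lift_eq_closure]; simp
  rw [h]
  have : Countable (FreeAddGroup s) := Quot.mk_surjective.countable
  exact (AddMonoidHom.rangeRestrict_surjective _).countable

def auxGood {α X : Type*} [MeasurableSpace α] (μ : Measure α) [NormedAddCommGroup X]
    [NormedSpace ℝ X] (Φ : Lp X 2 μ →L[ℝ] ℝ) (m : α → ℝ) : Prop :=
  Measurable m ∧ MemLp m 2 μ ∧ ∀ f : α → ℝ, MemLp f 2 μ →
    ∃ l : Lp X 2 μ, (∀ᵐ ξ ∂μ, ‖l ξ‖ ≤ ‖f ξ‖) ∧ Φ l = ∫ ξ, m ξ * f ξ ∂μ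

theorem auxGood.sup {α X : Type*} [MeasurableSpace α] {μ : Measure α} [NormedAddCommGroup X]
    [NormedSpace ℝ X] {Φ : Lp X 2 μ →L[ℝ] ℝ} {m m' : α → ℝ}
    (h : auxGood μ Φ m) (h' : auxGood μ Φ m') : auxGood μ Φ (m ⊔ m') := by
  refine ⟨h.1.sup h'.1, h.2.1.sup h'.2.1, ?_⟩
  intro f hf
  have hA : MeasurableSet {ξ | m' ξ ≤ m ξ} := measurableSet_le h'.1 h.1
  set A := {ξ | m' ξ ≤ m ξ} with hAdef
  obtain ⟨l, hl, hl2⟩ := h.2.2 (A.indicator f) (hf.indicator hA)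
  obtain ⟨l', hl', hl2'⟩ := h'.2.2 (Aᶜ.indicator f) (hf.indicator hA.compl)
  refine ⟨l + l', ?_, ?_⟩
  · filter_upwards [hl, hl', Lp.coeFn_add l l'] with ξ h1 h2 h3
    rw [h3, Pi.add_apply]
    refine (norm_add_le _ _).trans ((add_le_add h1 h2).trans ?_)
    by_cases hξ : ξ ∈ A
    · simp [hξ]
    · simp [hξ]
  · rw [map_add, hl2, hl2', ← integral_add]
    · congr 1
      ext ξ
      by_cases hξ : ξ ∈ A
      · have : m' ξ ≤ m ξ := hξ
        simp [hξ, this]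
      · have : m ξ ≤ m' ξ := by
          have : ¬ (m' ξ ≤ m ξ) := hξ
          linarith
        simp [hξ, this]
    · exact h.2.1.integrable_mul (hf.indicator hA)
    · exact h'.2.1.integrable_mul (hf.indicator hA.compl)

theorem auxGood.bound {α X : Type*} [MeasurableSpace α] {μ : Measure α} [NormedAddCommGroup X]
    [NormedSpace ℝ X] {Φ : Lp X 2 μ →L[ℝ] ℝ} {m : α → ℝ}
    (h : auxGood μ Φ m) : ∫⁻ ξ, (ENNReal.ofReal (m ξ)) ^ 2 ∂μ ≤ ENNReal.ofReal (‖Φ‖ ^ 2) := by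
  obtain ⟨l, hl, hl2⟩ := h.2.2 m h.2.1
  set L : Lp ℝ 2 μ := h.2.1.toLp m with hL
  have hLm : L =ᵐ[μ] m := h.2.1.coeFn_toLp
  have h1 : ‖l‖ ≤ ‖L‖ := by
    apply Lp.norm_le_norm_of_ae_le
    filter_upwards [hl, hLm] with ξ h1 h2
    rw [h2]; exact h1
  have h2 : ∫ ξ, m ξ * m ξ ∂μ = ‖L‖ ^ 2 := by
    rw [← real_inner_self_eq_norm_sq, L2.inner_def]
    apply integral_congr_ae
    filter_upwards [hLm] with ξ h2
    rw [h2]; simp [sq]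
  have h3 : ‖L‖ ^ 2 ≤ ‖Φ‖ * ‖L‖ := by
    rw [← h2, ← hl2]
    exact (le_abs_self _).trans ((Φ.le_opNorm l).trans (by gcongr))
  have h4 : ‖L‖ ≤ ‖Φ‖ := by
    by_contra hc
    push Not at hc
    have := norm_nonneg Φ
    nlinarith
  have h5 : ∫ ξ, m ξ * m ξ ∂μ ≤ ‖Φ‖ ^ 2 := by
    rw [h2]; gcongr
  refine le_trans ?_ (ENNReal.ofReal_le_ofReal h5)
  have hint : Integrable (fun ξ => m ξ * m ξ) μ := h.2.1.integrable_mul h.2.1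
  rw [ofReal_integral_eq_lintegral_ofReal hint
    (Eventually.of_forall fun ξ => mul_self_nonneg _)]
  apply lintegral_mono
  intro ξ
  simp only
  rcases le_total 0 (m ξ) with h0 | h0
  · rw [ENNReal.ofReal_mul h0, sq]
  · simp [ENNReal.ofReal_of_nonpos h0]

theorem aux_maximal {α X : Type*} [MeasurableSpace α] {μ : Measure α} [NormedAddCommGroup X]
    [NormedSpace ℝ X] {Φ : Lp X 2 μ →L[ℝ] ℝ} (s : ℕ → α → ℝ) (hs : ∀ i, auxGood μ Φ (s i)) :
    ∃ M : α → ℝ≥0∞, Measurable M ∧ ∫⁻ ξ, M ξ ^ 2 ∂μ ≤ ENNReal.ofReal (‖Φ‖ ^ 2) ∧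
      ∀ i ξ, ENNReal.ofReal (s i ξ) ≤ M ξ := by
  have hps : ∀ n, auxGood μ Φ (partialSups s n) := by
    intro n
    induction n with
    | zero => simpa using hs 0
    | succ n ih => rw [partialSups_add_one]; exact ih.sup (hs _)
  refine ⟨fun ξ => ⨆ n, ENNReal.ofReal (partialSups s n ξ), ?_, ?_, ?_⟩
  · exact Measurable.iSup fun n => (hps n).1.ennreal_ofReal
  · have : ∀ ξ, (⨆ n, ENNReal.ofReal (partialSups s n ξ)) ^ 2
        = ⨆ n, (ENNReal.ofReal (partialSups s n ξ)) ^ 2 := by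
      intro ξ
      exact ENNReal.iSup_pow_of_ne_zero two_ne_zero (fun n => ENNReal.ofReal (partialSups s n ξ))
    simp_rw [this]
    rw [lintegral_iSup]
    · exact iSup_le fun n => (hps n).bound
    · exact fun n => (hps n).1.ennreal_ofReal.pow_const 2
    · intro a b hab ξ
      have := (partialSups s).monotone hab ξ
      simp only
      gcongr
  · intro i ξ
    exact (ENNReal.ofReal_le_ofReal (le_partialSups s i ξ)).trans
      (le_iSup (fun n => ENNReal.ofReal (partialSups s n ξ)) i)

theorem aux_repr {α X : Type*} [MeasurableSpace α] (μ : Measure α)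
    [NormedAddCommGroup X] [NormedSpace ℝ X] [TopologicalSpace.SeparableSpace X]
    [TopologicalSpace.SeparableSpace (X →L[ℝ] ℝ)] (Φ : Lp X 2 μ →L[ℝ] ℝ) :
    ∃ h : Lp (X →L[ℝ] ℝ) 2 μ, ∀ l : Lp X 2 μ, Φ l = ∫ ξ, h ξ (l ξ) ∂μ := by
  let Q : X →L[ℝ] Lp ℝ 2 μ →L[ℝ] Lp X 2 μ :=
    (ContinuousLinearMap.lsmul ℝ ℝ).flip.compLpL₂ 2 μ
  have hQ : ∀ x f, Q x f =ᵐ[μ] fun ξ => f ξ • x := fun x f =>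
    ContinuousLinearMap.coeFn_compLp _ f
  let S : X → Lp ℝ 2 μ := fun x => (InnerProductSpace.toDual ℝ (Lp ℝ 2 μ)).symm (Φ ∘L Q x)
  have hS : ∀ x f, Φ (Q x f) = ∫ ξ, S x ξ * f ξ ∂μ := by
    intro x f
    have : inner ℝ (S x) f = Φ (Q x f) := by
      simp [S, InnerProductSpace.toDual_symm_apply]
    rw [← this, L2.inner_def]
    congr 1
    ext ξ
    simp [mul_comm]
  have hSadd : ∀ x y, S (x + y) = S x + S y := by
    intro x y
    simp only [S]
    rw [← map_add]
    congr 1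
    ext f; simp
  have hSsmul : ∀ (c : ℝ) x, S (c • x) = c • S x := by
    intro c x
    simp only [S]
    have : Φ ∘L Q (c • x) = c • (Φ ∘L Q x) := by ext f; simp
    rw [this, LinearIsometryEquiv.map_smulₛₗ]
    simp
  have hgood : ∀ x, ‖x‖ ≤ 1 → auxGood μ Φ (S x) := by
    intro x hx
    refine ⟨(Lp.stronglyMeasurable _).measurable, Lp.memLp _, fun f hf => ⟨Q x (hf.toLp f), ?_, ?_⟩⟩
    · filter_upwards [hQ x (hf.toLp f), hf.coeFn_toLp] with ξ h1 h2
      rw [h1, h2, norm_smul]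
      exact mul_le_of_le_one_right (norm_nonneg _) hx
    · rw [hS]
      apply integral_congr_ae
      filter_upwards [hf.coeFn_toLp] with ξ h2
      rw [h2]
  let D : AddSubgroup X := AddSubgroup.closure (range (TopologicalSpace.denseSeq X))
  have hDd : Dense (D : Set X) :=
    (TopologicalSpace.denseRange_denseSeq X).mono AddSubgroup.subset_closure
  have hDc : Countable D := by
    exact aux_countable_closure (countable_range _)
  obtain ⟨d, hd⟩ := exists_surjective_nat D
  let v : ℕ → X := fun i => ‖(d i : X)‖⁻¹ • (d i : X)
  have hv : ∀ i, ‖v i‖ ≤ 1 := by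
    intro i
    simp only [v, norm_smul, norm_inv, norm_norm]
    exact inv_mul_le_one
  have hdv : ∀ i, (d i : X) = ‖(d i : X)‖ • v i := by
    intro i
    simp only [v]
    by_cases h0 : (d i : X) = 0
    · simp [h0]
    · rw [smul_smul, mul_inv_cancel₀ (norm_ne_zero_iff.2 h0), one_smul]
  obtain ⟨M, hMm, hM2, hMs⟩ := aux_maximal (μ := μ) (Φ := Φ) (fun i => S (v i))
    (fun i => hgood _ (hv i))
  have hMfin : ∀ᵐ ξ ∂μ, M ξ < ∞ := by
    have := ae_lt_top (hMm.pow_const 2) (hM2.trans_lt ENNReal.ofReal_lt_top).ne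
    filter_upwards [this] with ξ hξ
    by_contra hc
    rw [not_lt, top_le_iff] at hc
    simp [hc] at hξ
  have hae1 : ∀ᵐ ξ ∂μ, ∀ x y : D, S (x + y) ξ = S x ξ + S y ξ := by
    rw [ae_all_iff]; intro x
    rw [ae_all_iff]; intro y
    rw [hSadd]
    exact Lp.coeFn_add _ _
  have hae2 : ∀ᵐ ξ ∂μ, ∀ i, S (d i) ξ = ‖(d i : X)‖ * S (v i) ξ := by
    rw [ae_all_iff]; intro i
    have : S (d i) = ‖(d i : X)‖ • S (v i) := by rw [← hSsmul, ← hdv]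
    rw [this]
    exact Lp.coeFn_smul _ _
  have hex : ∀ ξ, ∃ F : X →L[ℝ] ℝ, (M ξ < ∞ → (∀ x y : D, S (x + y) ξ = S x ξ + S y ξ) →
      (∀ i, S (d i) ξ = ‖(d i : X)‖ * S (v i) ξ) →
      ‖F‖ₑ ≤ M ξ ∧ ∀ x : D, F x = S x ξ) := by
    intro ξ
    by_cases hcond : M ξ < ∞ ∧ (∀ x y : D, S (x + y) ξ = S x ξ + S y ξ) ∧
      (∀ i, S (d i) ξ = ‖(d i : X)‖ * S (v i) ξ)
    swap
    · exact ⟨0, fun a b c => absurd ⟨a, b, c⟩ hcond⟩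
    obtain ⟨c1, c2, c3⟩ := hcond
    have hle : ∀ x ∈ D, S x ξ ≤ (M ξ).toNNReal * ‖x‖ := by
      intro x hx
      obtain ⟨i, hi⟩ := hd ⟨x, hx⟩
      have hi' : (d i : X) = x := by rw [hi]
      have h1 := c3 i
      rw [hi'] at h1
      rw [h1, mul_comm]
      gcongr
      have := hMs i ξ
      exact ENNReal.ofReal_le_iff_le_toReal c1.ne |>.1 this
    have hz : S 0 ξ = 0 := by
      have := c2 0 0
      simp at this
      exact this
    obtain ⟨F, hF1, hF2⟩ := aux_extend D hDd (fun x => S x ξ)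
      (fun x hx y hy => c2 ⟨x, hx⟩ ⟨y, hy⟩) (M ξ).toNNReal (by
        intro x hx
        rw [abs_le]
        refine ⟨?_, hle x hx⟩
        have h1 := hle (-x) (D.neg_mem hx)
        have h2 := c2 ⟨x, hx⟩ ⟨-x, D.neg_mem hx⟩
        simp only [add_neg_cancel, hz] at h2
        rw [norm_neg] at h1
        linarith)
    refine ⟨F, fun _ _ _ => ⟨?_, fun x => hF2 x x.2⟩⟩
    rw [← ENNReal.coe_toNNReal c1.ne]
    exact enorm_le_coe.2 hF1
  choose h hh using hex
  have hprop : ∀ᵐ ξ ∂μ, ‖h ξ‖ₑ ≤ M ξ ∧ ∀ x : D, h ξ x = S x ξ := by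
    filter_upwards [hMfin, hae1, hae2] with ξ a b c using hh ξ a b c
  have hmeas : AEStronglyMeasurable h μ := by
    borelize (X →L[ℝ] ℝ)
    let ρ : (X →L[ℝ] ℝ) → (ℕ → ℝ) := fun f i => f (d i)
    have hρc : Continuous ρ := by
      apply continuous_pi
      intro i
      exact (ContinuousLinearMap.apply ℝ ℝ (d i : X)).continuous
    have hρi : Function.Injective ρ := by
      intro f f' hff
      have : (f : X → ℝ) = f' := by
        apply Continuous.ext_on hDd f.continuous f'.continuous
        intro x hx
        obtain ⟨i, hi⟩ := hd ⟨x, hx⟩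
        have hi' : (d i : X) = x := by rw [hi]
        rw [← hi']
        exact congrFun hff i
      exact DFunLike.coe_injective this
    have hme : MeasurableEmbedding ρ := hρc.measurableEmbedding hρi
    have : AEMeasurable (ρ ∘ h) μ := by
      refine ⟨fun ξ i => S (d i) ξ, ?_, ?_⟩
      · exact measurable_pi_lambda _ fun i => (Lp.stronglyMeasurable _).measurable
      · filter_upwards [hprop] with ξ hξ
        ext i
        exact hξ.2 (d i)
    exact (hme.aemeasurable_comp_iff.1 this).aestronglyMeasurable
  have hmem : MemLp h 2 μ := by
    refine ⟨hmeas, ?_⟩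
    rw [eLpNorm_lt_top_iff_lintegral_rpow_enorm_lt_top two_ne_zero ENNReal.ofNat_ne_top]
    refine lt_of_le_of_lt ?_ (hM2.trans_lt ENNReal.ofReal_lt_top)
    apply lintegral_mono_ae
    filter_upwards [hprop] with ξ hξ
    simp only [ENNReal.toReal_ofNat, ENNReal.rpow_ofNat]
    gcongr
    exact hξ.1
  refine ⟨hmem.toLp h, ?_⟩
  have hco : hmem.toLp h =ᵐ[μ] h := hmem.coeFn_toLp
  let Ψ : Lp X 2 μ →L[ℝ] ℝ :=
    (ContinuousLinearMap.id ℝ (X →L[ℝ] ℝ)).lpPairing μ 2 2 (hmem.toLp h)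
  have hΨ : ∀ l, Ψ l = ∫ ξ, (hmem.toLp h) ξ (l ξ) ∂μ := fun l =>
    ContinuousLinearMap.lpPairing_eq_integral _ _ _
  have hQeq : ∀ x f, Φ (Q x f) = Ψ (Q x f) := by
    intro x f
    have hc1 : Continuous (fun x => Φ (Q x f)) := by fun_prop
    have hc2 : Continuous (fun x => Ψ (Q x f)) := by fun_prop
    refine congrFun (Continuous.ext_on hDd hc1 hc2 ?_) x
    intro x hx
    simp only
    rw [hS, hΨ]
    apply integral_congr_ae
    filter_upwards [hprop, hco, hQ x f] with ξ h1 h2 h3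
    rw [h2, h3, map_smul, smul_eq_mul, mul_comm]
    congr 1
    exact (h1.2 ⟨x, hx⟩).symm
  intro l
  rw [← hΨ]
  refine Lp.induction ENNReal.ofNat_ne_top (fun l => Φ l = Ψ l) ?_ ?_ ?_ l
  · intro c s hs hμs
    have := hQeq c (indicatorConstLp 2 hs hμs.ne 1)
    have h2 : Q c (indicatorConstLp 2 hs hμs.ne 1) =
      (Lp.simpleFunc.indicatorConst 2 hs hμs.ne c : Lp X 2 μ) := by
      rw [Lp.simpleFunc.coe_indicatorConst, indicatorConstLp_eq_toSpanSingleton_compLp hs hμs.ne c]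
      rfl
    rw [← h2]; exact this
  · intro f g hf hg _ h1 h2
    rw [map_add, map_add, h1, h2]
  · exact isClosed_eq Φ.continuous Ψ.continuous

theorem aux_reflexive {α X : Type*} [MeasurableSpace α] (μ : Measure α)
    [NormedAddCommGroup X] [NormedSpace ℝ X] [TopologicalSpace.SeparableSpace X]
    (hX : Function.Surjective ⇑(NormedSpace.inclusionInDoubleDual ℝ X)) :
    Function.Surjective ⇑(NormedSpace.inclusionInDoubleDual ℝ (Lp X 2 μ)) := by
  let e : X ≃ₗᵢ[ℝ] ((X →L[ℝ] ℝ) →L[ℝ] ℝ) :=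
    LinearIsometryEquiv.ofSurjective (NormedSpace.inclusionInDoubleDualLi ℝ (E := X)) hX
  have he : ∀ x f, e x f = f x := fun x f => rfl
  have i1 : TopologicalSpace.SeparableSpace ((X →L[ℝ] ℝ) →L[ℝ] ℝ) :=
    e.surjective.denseRange.separableSpace e.continuous
  have i2 : TopologicalSpace.SeparableSpace (X →L[ℝ] ℝ) := aux_sep_of_dual
  intro Ψ
  let ι : Lp (X →L[ℝ] ℝ) 2 μ →L[ℝ] Lp X 2 μ →L[ℝ] ℝ :=
    (ContinuousLinearMap.id ℝ (X →L[ℝ] ℝ)).lpPairing μ 2 2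
  have hι : ∀ h l, ι h l = ∫ ξ, h ξ (l ξ) ∂μ := fun h l =>
    ContinuousLinearMap.lpPairing_eq_integral _ _ _
  obtain ⟨k, hk⟩ := aux_repr μ (Ψ ∘L ι)
  let ei : ((X →L[ℝ] ℝ) →L[ℝ] ℝ) →L[ℝ] X := (e.symm.toContinuousLinearEquiv : _ →L[ℝ] _)
  refine ⟨ei.compLp k, ?_⟩
  ext Φ
  obtain ⟨h, hh⟩ := aux_repr μ Φ
  have hΦ : Φ = ι h := by ext l; rw [hh, hι]
  rw [NormedSpace.dual_def, hh, hΦ]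
  have := hk h
  simp only [ContinuousLinearMap.comp_apply] at this
  rw [this]
  apply integral_congr_ae
  filter_upwards [ei.coeFn_compLp k] with ξ hξ
  rw [hξ, ← he]
  simp [ei]

theorem aux_weak_compact {E : Type*} [NormedAddCommGroup E] [NormedSpace ℝ E]
    (hE : Function.Surjective ⇑(NormedSpace.inclusionInDoubleDual ℝ E)) (r : ℝ) :
    @IsCompact E (weakTop E) (Metric.closedBall 0 r) := by
  let J : E → WeakDual ℝ (E →L[ℝ] ℝ) := fun x =>
    StrongDual.toWeakDual (NormedSpace.inclusionInDoubleDual ℝ E x)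
  have hJ : @Topology.IsInducing _ _ (weakTop E) _ J := by
    refine @Topology.IsInducing.mk _ _ (weakTop E) _ J ?_
    change TopologicalSpace.induced _ _ = TopologicalSpace.induced J (TopologicalSpace.induced _ _)
    exact (induced_compose (f := J)
      (g := fun (x : WeakDual ℝ (E →L[ℝ] ℝ)) (y : E →L[ℝ] ℝ) => x y)).symm
  refine (@Topology.IsInducing.isCompact_iff _ _ (weakTop E) _ _ J hJ).2 ?_
  have hbal : ∀ z : (E →L[ℝ] ℝ) →L[ℝ] ℝ, z ∈ Metric.closedBall (0 : (E →L[ℝ] ℝ) →L[ℝ] ℝ) r ↔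
      ‖z‖ ≤ r := fun z => mem_closedBall_zero_iff (E := (E →L[ℝ] ℝ) →L[ℝ] ℝ)
  have : J '' Metric.closedBall 0 r =
      WeakDual.toStrongDual ⁻¹' Metric.closedBall (0 : (E →L[ℝ] ℝ) →L[ℝ] ℝ) r := by
    ext y
    constructor
    · rintro ⟨x, hx, rfl⟩
      rw [mem_closedBall_zero_iff] at hx
      refine (hbal _).2 ?_
      exact ((NormedSpace.inclusionInDoubleDualLi ℝ (E := E)).norm_map x).le.trans hx
    · intro hy
      obtain ⟨x, hx⟩ := hE (WeakDual.toStrongDual y)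
      refine ⟨x, ?_, ?_⟩
      · have hy' : ‖WeakDual.toStrongDual y‖ ≤ r := (hbal (WeakDual.toStrongDual y)).1 hy
        rw [mem_closedBall_zero_iff]
        rw [← hx] at hy'
        exact ((NormedSpace.inclusionInDoubleDualLi ℝ (E := E)).norm_map x).ge.trans hy'
      · simp only [J, hx]; rfl
  rw [this]
  exact WeakDual.isCompact_closedBall _ _

theorem aux_weak_closed {E : Type*} [NormedAddCommGroup E] [NormedSpace ℝ E]
    {A : Set E} (hA : IsClosed A) (hc : Convex ℝ A) : @IsClosed E (weakTop E) A := by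
  refine @isOpen_compl_iff _ _ (weakTop E) |>.1 ?_
  rw [@isOpen_iff_forall_mem_open _ (weakTop E)]
  intro x hx
  obtain ⟨f, u, h1, h2⟩ := geometric_hahn_banach_closed_point hc hA hx
  refine ⟨{y | u < f y}, ?_, ?_, h2⟩
  · intro y hy hyA
    exact lt_irrefl _ ((h1 y hyA).trans hy)
  · have : @Continuous _ _ (weakTop E) _ (fun y => f y) := by
      have := @continuous_induced_dom E ((E →L[ℝ] ℝ) → ℝ)
        (fun (x : E) (f : E →L[ℝ] ℝ) => f x) inferInstance
      exact @Continuous.comp _ _ _ (weakTop E) _ _ _ (fun p : (E →L[ℝ] ℝ) → ℝ => p f)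
        (continuous_apply f) this
    exact @IsOpen.preimage _ _ (weakTop E) _ _ this _ (isOpen_Ioi (a := u))

theorem aux_nested {E : Type*} [NormedAddCommGroup E] [NormedSpace ℝ E]
    (hE : Function.Surjective ⇑(NormedSpace.inclusionInDoubleDual ℝ E)) (r : ℝ)
    (A : ℕ → Set E) (hcl : ∀ n, IsClosed (A n)) (hcv : ∀ n, Convex ℝ (A n)) (hanti : Antitone A)
    (hbd : ∀ n, A n ⊆ Metric.closedBall 0 r) (O : Set E) (hO : @IsOpen E (weakTop E) O)
    (hAO : ⋂ n, A n ⊆ O) : ∃ n, A n ⊆ O := by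
  have hOc : @IsClosed E (weakTop E) Oᶜ := @isClosed_compl_iff _ (weakTop E) _ |>.2 hO
  obtain ⟨n, hn⟩ := @IsCompact.elim_directed_family_closed E (weakTop E) _ ℕ _
    (aux_weak_compact hE r) (fun n => A n ∩ Oᶜ)
    (fun n => @IsClosed.inter _ _ _ (weakTop E) (aux_weak_closed (hcl n) (hcv n)) hOc) (by
      rw [← iInter_inter]
      ext x
      simp only [mem_inter_iff, mem_empty_iff_false, iff_false]
      rintro ⟨_, h1, h2⟩
      exact h2 (hAO h1))
    (directed_of_isDirected_le fun i j hij => inter_subset_inter_left _ (hanti hij))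
  refine ⟨n, fun x hx => ?_⟩
  by_contra hxO
  have : x ∈ (∅ : Set E) := hn ▸ ⟨hbd n hx, hx, hxO⟩
  exact this

section LpSets
variable {α X : Type*} [MeasurableSpace α] {μ : Measure α} [NormedAddCommGroup X] [NormedSpace ℝ X]

theorem aux_Lp_closed (C : α → Set X) (hC : ∀ ξ, IsClosed (C ξ)) :
    IsClosed {l : Lp X 2 μ | ∀ᵐ ξ ∂μ, l ξ ∈ C ξ} := by
  apply IsSeqClosed.isClosed
  intro x l hx hl
  obtain ⟨ns, _, hns⟩ := (tendstoInMeasure_of_tendsto_Lp hl).exists_seq_tendsto_ae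
  have hx' : ∀ᵐ ξ ∂μ, ∀ n, x n ξ ∈ C ξ := ae_all_iff.2 hx
  change ∀ᵐ ξ ∂μ, l ξ ∈ C ξ
  filter_upwards [hns, hx'] with ξ h1 h2
  exact (hC ξ).mem_of_tendsto h1 (Eventually.of_forall fun i => h2 _)

theorem aux_Lp_convex (C : α → Set X) (hC : ∀ ξ, Convex ℝ (C ξ)) :
    Convex ℝ {l : Lp X 2 μ | ∀ᵐ ξ ∂μ, l ξ ∈ C ξ} := by
  intro x hx y hy a b ha hb hab
  change ∀ᵐ ξ ∂μ, _ ∈ C ξ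
  filter_upwards [hx, hy, Lp.coeFn_add (a • x) (b • y), Lp.coeFn_smul a x, Lp.coeFn_smul b y]
    with ξ h1 h2 h3 h4 h5
  rw [h3, Pi.add_apply, h4, h5]
  exact hC ξ h1 h2 ha hb hab

end LpSets

section VI
variable {X : Type*} [NormedAddCommGroup X] [NormedSpace ℝ X]

/-- Relaxed Minty solution set. -/
def auxC (K : Set X) (G : X → (X →L[ℝ] ℝ)) (φ : X → EReal) (R ε : ℝ) (w : X →L[ℝ] ℝ) : Set X :=
  {u | u ∈ K ∧ ‖u‖ ≤ R ∧ ∀ v ∈ K, φ v ≠ ⊤ →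
    φ u ≤ ((w (v - u) + G v (v - u) + (φ v).toReal + ε * (‖v‖ + R) : ℝ) : EReal)}

theorem auxC_closed {K : Set X} (hK : IsClosed K) (G : X → (X →L[ℝ] ℝ)) {φ : X → EReal}
    (hφ : LowerSemicontinuous φ) (R ε : ℝ) (w : X →L[ℝ] ℝ) : IsClosed (auxC K G φ R ε w) := by
  have : auxC K G φ R ε w = K ∩ ({u | ‖u‖ ≤ R} ∩ ⋂ v ∈ K, ⋂ (_ : φ v ≠ ⊤), {u | φ u ≤
    ((w (v - u) + G v (v - u) + (φ v).toReal + ε * (‖v‖ + R) : ℝ) : EReal)}) := by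
    ext u
    simp only [mem_inter_iff, mem_iInter]
    exact Iff.rfl
  rw [this]
  refine hK.inter ((isClosed_le continuous_norm continuous_const).inter ?_)
  refine isClosed_iInter fun v => isClosed_iInter fun hv => isClosed_iInter fun hv' => ?_
  have hc : Continuous (fun u : X => (u,
      ((w (v - u) + G v (v - u) + (φ v).toReal + ε * (‖v‖ + R) : ℝ) : EReal))) := by
    refine continuous_id.prodMk (continuous_coe_real_ereal.comp ?_)
    fun_prop
  exact hφ.isClosed_epigraph.preimage hc

theorem auxC_convex {K : Set X} (hK : Convex ℝ K) (G : X → (X →L[ℝ] ℝ)) {φ : X → EReal}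
    (hφ : condP2 φ) (R ε : ℝ) (w : X →L[ℝ] ℝ) : Convex ℝ (auxC K G φ R ε w) := by
  intro x hx y hy a b ha hb hab
  obtain rfl : b = 1 - a := by linarith
  refine ⟨hK hx.1 hy.1 ha hb hab, ?_, ?_⟩
  · have := (convex_closedBall (0 : X) R) (mem_closedBall_zero_iff.2 hx.2.1)
      (mem_closedBall_zero_iff.2 hy.2.1) ha hb hab
    exact mem_closedBall_zero_iff.1 this
  · intro v hv hvt
    refine (hφ.2.2.1 x y a ⟨ha, by linarith⟩).trans ?_
    have h1 := hx.2.2 v hv hvt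
    have h2 := hy.2.2 v hv hvt
    refine (add_le_add (mul_le_mul_of_nonneg_left h1 (EReal.coe_nonneg.2 ha))
      (mul_le_mul_of_nonneg_left h2 (EReal.coe_nonneg.2 hb))).trans (le_of_eq ?_)
    norm_cast
    simp only [map_sub, map_add, map_smul, smul_eq_mul]
    ring

theorem auxSOL_ne_top {K : Set X} {G : X → (X →L[ℝ] ℝ)} {φ : X → EReal} {w : X →L[ℝ] ℝ} {u : X}
    (hu : u ∈ SOL K G φ w) {vs : X} (hvs : vs ∈ K) (ht : φ vs ≠ ⊤) : φ u ≠ ⊤ := by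
  intro h
  have := hu.2 vs hvs
  rw [h, top_le_iff] at this
  exact (EReal.add_ne_top (EReal.coe_ne_top _) ht) this

theorem auxSOL_bound {K : Set X} {G : X → (X →L[ℝ] ℝ)} {φ : X → EReal} (hP2 : condP2 φ)
    (hP3 : condP3 K G φ) (C : ℝ) :
    ∃ R : ℝ, ∀ w : X →L[ℝ] ℝ, ‖w‖ ≤ C → ∀ u ∈ SOL K G φ w, ‖u‖ ≤ R := by
  obtain ⟨vs, hvs, hvt, hc⟩ := hP3
  obtain ⟨R, hR⟩ := hc (C + 1)
  refine ⟨max R (C * ‖vs‖), fun w hw u hu => ?_⟩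
  by_cases h : ‖u‖ < R
  · exact h.le.trans (le_max_left _ _)
  push Not at h
  refine le_trans ?_ (le_max_right _ _)
  have h1 := hR u hu.1 h
  have h2 := hu.2 vs hvs
  have ht := auxSOL_ne_top hu hvs hvt
  lift φ u to ℝ using ⟨ht, hP2.1 u⟩ with a
  lift φ vs to ℝ using ⟨hvt, hP2.1 vs⟩ with b
  norm_cast at h1 h2
  have h3 : w (vs - u) ≤ C * (‖vs‖ + ‖u‖) := by
    calc w (vs - u) ≤ ‖w (vs - u)‖ := le_abs_self _
      _ ≤ ‖w‖ * ‖vs - u‖ := w.le_opNorm _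
      _ ≤ C * (‖vs‖ + ‖u‖) := by
        have := norm_sub_le vs u
        gcongr
        exact (norm_nonneg _).trans hw
  have h4 : G u (vs - u) = - G u (u - vs) := by rw [← map_neg, neg_sub]
  nlinarith

theorem auxSOL_sub {K : Set X} {G : X → (X →L[ℝ] ℝ)} {φ : X → EReal} (hP1 : condP1 K G)
    (hP2 : condP2 φ) {w w' : X →L[ℝ] ℝ} {R ε : ℝ} (hw : ‖w' - w‖ ≤ ε) {u : X}
    (hu : u ∈ SOL K G φ w') (huR : ‖u‖ ≤ R) : u ∈ auxC K G φ R ε w := by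
  refine ⟨hu.1, huR, fun v hv hvt => ?_⟩
  refine (hu.2 v hv).trans ?_
  lift φ v to ℝ using ⟨hvt, hP2.1 v⟩ with b
  rw [EReal.toReal_coe]
  norm_cast
  have h1 := hP1.1 u hu.1 v hv
  have h2 : (w' - w) (v - u) ≤ ε * (‖v‖ + R) := by
    calc (w' - w) (v - u) ≤ ‖(w' - w) (v - u)‖ := le_abs_self _
      _ ≤ ‖w' - w‖ * ‖v - u‖ := (w' - w).le_opNorm _
      _ ≤ ε * (‖v‖ + R) := by
        have := norm_sub_le v u
        gcongr
        · exact (norm_nonneg _).trans hw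
        · linarith
  simp only [sub_apply] at h1 h2
  linarith

theorem auxC_inter {K : Set X} (hK : Convex ℝ K) {G : X → (X →L[ℝ] ℝ)} {φ : X → EReal}
    (hP1 : condP1 K G) (hP2 : condP2 φ) (hP3 : condP3 K G φ) {w : X →L[ℝ] ℝ} {R : ℝ} {u : X}
    (hu : ∀ n : ℕ, u ∈ auxC K G φ R (1 / ((n : ℝ) + 1)) w) : u ∈ SOL K G φ w := by
  have huK := (hu 0).1
  obtain ⟨vs, hvs, hvst, -⟩ := hP3
  have hut : φ u ≠ ⊤ := fun h => by
    have := (hu 0).2.2 vs hvs hvst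
    rw [h, top_le_iff] at this
    exact EReal.coe_ne_top _ this
  -- Minty inequality
  have hM : ∀ v ∈ K, φ v ≠ ⊤ → (φ u).toReal ≤ w (v - u) + G v (v - u) + (φ v).toReal := by
    intro v hv hvt
    have hn : ∀ n : ℕ, (φ u).toReal ≤
        w (v - u) + G v (v - u) + (φ v).toReal + 1 / ((n : ℝ) + 1) * (‖v‖ + R) := by
      intro n
      have := (hu n).2.2 v hv hvt
      rw [← EReal.coe_toReal hut (hP2.1 u)] at this
      exact EReal.coe_le_coe_iff.1 this
    have hlim : Tendsto (fun n : ℕ => w (v - u) + G v (v - u) + (φ v).toReal +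
        1 / ((n : ℝ) + 1) * (‖v‖ + R)) atTop
        (𝓝 (w (v - u) + G v (v - u) + (φ v).toReal + 0 * (‖v‖ + R))) :=
      tendsto_const_nhds.add (tendsto_one_div_add_atTop_nhds_zero_nat.mul_const _)
    have := ge_of_tendsto' hlim hn
    simpa using this
  refine ⟨huK, fun v hv => ?_⟩
  by_cases hvt : φ v = ⊤
  · rw [hvt, EReal.coe_add_top]; exact le_top
  have key : ∀ t ∈ Ioc (0 : ℝ) 1,
      (φ u).toReal ≤ w (v - u) + G (u + t • (v - u)) (v - u) + (φ v).toReal := by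
    intro t ht
    have he : u + t • (v - u) = t • v + (1 - t) • u := by
      rw [smul_sub, sub_smul, one_smul]; abel
    have hc := hP2.2.2.1 v u t ⟨ht.1.le, ht.2⟩
    have hz : u + t • (v - u) ∈ K := by
      rw [he]; exact hK hv huK ht.1.le (by linarith [ht.2]) (by ring)
    rw [← he] at hc
    have hcv : (t : EReal) * φ v + ((1 - t : ℝ) : EReal) * φ u
        = ((t * (φ v).toReal + (1 - t) * (φ u).toReal : ℝ) : EReal) := by
      conv_lhs => rw [← EReal.coe_toReal hut (hP2.1 u), ← EReal.coe_toReal hvt (hP2.1 v)]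
      norm_cast
    rw [hcv] at hc
    have hzt : φ (u + t • (v - u)) ≠ ⊤ := fun h => by
      rw [h, top_le_iff] at hc; exact EReal.coe_ne_top _ hc
    have hm := hM _ hz hzt
    rw [← EReal.coe_toReal hzt (hP2.1 _)] at hc
    have hc := EReal.coe_le_coe_iff.1 hc
    simp only [add_sub_cancel_left, map_smul, smul_eq_mul] at hm
    have : t * (φ u).toReal ≤
        t * (w (v - u) + G (u + t • (v - u)) (v - u) + (φ v).toReal) := by linarith
    exact le_of_mul_le_mul_left this ht.1
  have hcont := hP1.2 u huK v hv (v - u)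
  have h0 : Tendsto (fun t : ℝ => w (v - u) + G (u + t • (v - u)) (v - u) + (φ v).toReal)
      (𝓝[Ioc 0 1] 0) (𝓝 (w (v - u) + G u (v - u) + (φ v).toReal)) := by
    have h1 := (hcont 0 (by simp)).mono_left (nhdsWithin_mono 0 Ioc_subset_Icc_self)
    simp only [zero_smul, add_zero] at h1
    exact (tendsto_const_nhds.add h1).add_const _
  have hne : (𝓝[Ioc (0 : ℝ) 1] 0).NeBot := by
    rw [← mem_closure_iff_nhdsWithin_neBot, closure_Ioc (zero_ne_one)]
    simp
  have := ge_of_tendsto h0 (eventually_mem_nhdsWithin.mono key)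
  rw [← EReal.coe_toReal hut (hP2.1 u), ← EReal.coe_toReal hvt (hP2.1 v)]
  exact_mod_cast this

end VI

theorem aux_unif {Y Z : Type*} [NormedAddCommGroup Y] [NormedAddCommGroup Z] {T : ℝ} (hT : 0 ≤ T)
    (g : ℝ → Y → Z)
    (hg : ContinuousOn (fun p : ℝ × Y => g p.1 p.2) (Icc (0:ℝ) T ×ˢ univ))
    (θ₀ : C(Icc (0:ℝ) T, Y)) (ε : ℝ) (hε : 0 < ε) :
    ∃ δ > 0, ∀ θ : C(Icc (0:ℝ) T, Y), ‖θ - θ₀‖ < δ → ∀ ξ ∈ Icc (0:ℝ) T,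
      ‖g ξ (extIcc hT θ ξ) - g ξ (extIcc hT θ₀ ξ)‖ ≤ ε := by
  let gc : C(Icc (0:ℝ) T × Y, Z) := ⟨fun p => g p.1 p.2, by
    refine hg.comp_continuous (f := fun p : Icc (0:ℝ) T × Y => ((p.1 : ℝ), p.2)) (by fun_prop) ?_
    rintro ⟨p, y⟩
    exact ⟨p.2, mem_univ _⟩⟩
  let N : C(Icc (0:ℝ) T, Y) → C(Icc (0:ℝ) T, Z) := fun θ =>
    gc.comp ((ContinuousMap.id _).prodMk θ)
  have hN : Continuous N := by
    refine (ContinuousMap.continuous_postcomp gc).comp ?_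
    refine (LipschitzWith.of_dist_le_mul (K := 1) fun a b => ?_).continuous
    rw [NNReal.coe_one, one_mul, ContinuousMap.dist_le dist_nonneg]
    intro x
    simp only [ContinuousMap.prod_eval, Prod.dist_eq, dist_self]
    exact max_le dist_nonneg (ContinuousMap.dist_apply_le_dist x)
  obtain ⟨δ, hδ, h⟩ := Metric.continuous_iff.1 hN θ₀ ε hε
  refine ⟨δ, hδ, fun θ hθ ξ hξ => ?_⟩
  have h1 := h θ (by rwa [dist_eq_norm])
  have h2 := (ContinuousMap.dist_apply_le_dist (f := N θ) (g := N θ₀) ⟨ξ, hξ⟩).trans h1.le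
  rw [dist_eq_norm] at h2
  simp only [extIcc, projIcc_of_mem hT hξ]
  exact h2

/-- **Lemma 4.1**: the multimap `P_U : C([0,T],Ω₂) → P(L²([0,T],Ω₁))` is
strongly-weakly upper semicontinuous. -/
theorem PU_strongly_weakly_usc
    {Ω₁ Ω₂ : Type*} [NormedAddCommGroup Ω₁] [NormedSpace ℝ Ω₁] [CompleteSpace Ω₁]
    [TopologicalSpace.SeparableSpace Ω₁]
    [NormedAddCommGroup Ω₂] [NormedSpace ℝ Ω₂] [CompleteSpace Ω₂]
    [TopologicalSpace.SeparableSpace Ω₂]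
    (hΩ₁refl : Function.Surjective ⇑(NormedSpace.inclusionInDoubleDual ℝ Ω₁))
    (hΩ₂refl : Function.Surjective ⇑(NormedSpace.inclusionInDoubleDual ℝ Ω₂))
    (K : Set Ω₁) (hKne : K.Nonempty) (hKcl : IsClosed K) (hKcv : Convex ℝ K)
    (G : Ω₁ → (Ω₁ →L[ℝ] ℝ)) (φ : Ω₁ → EReal)
    (hP1 : condP1 K G) (hP2 : condP2 φ) (hP3 : condP3 K G φ)
    {T : ℝ} (hT : 0 < T)
    (g : ℝ → Ω₂ → (Ω₁ →L[ℝ] ℝ)) (hP4 : condP4 T g)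
    (hSOLne : ∀ w : Ω₁ →L[ℝ] ℝ, (SOL K G φ w).Nonempty) :
    ∀ θ₀ : C(Icc (0:ℝ) T, Ω₂),
      ∀ O : Set (Lp Ω₁ 2 (volume.restrict (Icc (0:ℝ) T))),
      @IsOpen _ (weakTop (Lp Ω₁ 2 (volume.restrict (Icc (0:ℝ) T)))) O →
      PULp K G φ hT.le g θ₀ ⊆ O →
      ∃ δ : ℝ, 0 < δ ∧ ∀ θ : C(Icc (0:ℝ) T, Ω₂), ‖θ - θ₀‖ < δ →
        PULp K G φ hT.le g θ ⊆ O := by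
  intro θ₀ O hO hPO
  obtain ⟨hgc, C, hC⟩ := hP4
  obtain ⟨R, hR⟩ := auxSOL_bound hP2 hP3 C
  let μ : Measure ℝ := volume.restrict (Icc (0:ℝ) T)
  let w : ℝ → (Ω₁ →L[ℝ] ℝ) := fun ξ => g ξ (extIcc hT.le θ₀ ξ)
  let A : ℕ → Set (Lp Ω₁ 2 μ) := fun n =>
    {l | ∀ᵐ ξ ∂μ, l ξ ∈ auxC K G φ R (1 / ((n : ℝ) + 1)) (w ξ)}
  have hIcc : ∀ᵐ ξ ∂μ, ξ ∈ Icc (0:ℝ) T := ae_restrict_mem measurableSet_Icc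
  -- uniform norm bound
  have hcst : MemLp (fun _ : ℝ => R) 2 μ := memLp_const R
  have hAbd : ∀ n, A n ⊆ Metric.closedBall 0 ‖hcst.toLp _‖ := by
    intro n l hl
    rw [mem_closedBall_zero_iff]
    apply Lp.norm_le_norm_of_ae_le
    filter_upwards [hl, hcst.coeFn_toLp] with ξ h1 h2
    rw [h2]
    exact h1.2.1.trans (le_abs_self _)
  have hanti : Antitone A := by
    intro m n hmn l hl
    change ∀ᵐ ξ ∂μ, _
    filter_upwards [hl] with ξ h1
    refine ⟨h1.1, h1.2.1, fun v hv hvt => (h1.2.2 v hv hvt).trans ?_⟩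
    have hR0 : 0 ≤ R := (norm_nonneg _).trans h1.2.1
    rw [EReal.coe_le_coe_iff]
    gcongr
  obtain ⟨n, hn⟩ := aux_nested (aux_reflexive μ hΩ₁refl) _ A
    (fun n => aux_Lp_closed _ fun ξ => auxC_closed hKcl G hP2.2.2.2 _ _ _)
    (fun n => aux_Lp_convex _ fun ξ => auxC_convex hKcv G hP2 _ _ _) hanti hAbd O hO (by
      refine Subset.trans ?_ hPO
      intro l hl
      have hl' : ∀ᵐ ξ ∂μ, ∀ n : ℕ, l ξ ∈ auxC K G φ R (1 / ((n : ℝ) + 1)) (w ξ) :=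
        ae_all_iff.2 fun n => mem_iInter.1 hl n
      change ∀ᵐ ξ ∂μ, _
      filter_upwards [hl'] with ξ h1
      exact auxC_inter hKcv hP1 hP2 hP3 h1)
  obtain ⟨δ, hδ, h⟩ := aux_unif hT.le g hgc θ₀ (1 / ((n : ℝ) + 1)) (by positivity)
  refine ⟨δ, hδ, fun θ hθ l hl => hn ?_⟩
  change ∀ᵐ ξ ∂μ, _
  filter_upwards [hl, hIcc] with ξ h1 h2
  exact auxSOL_sub hP1 hP2 (h θ hθ ξ h2) h1 (hR _ (hC ξ h2 _) _ h1)
end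
end
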